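/- arXiv:2510.02632 — 3 statements merged into one kernel-verified Lean document; each statement's English description precedes it below -/
import Mathlib

section
/- Let x, y, t, p be real numbers with r := √(x² + y²) satisfying 0 < r < 1 and with t ≠ 0, and set Q := √(p² + 16t²). Suppose real numbers α, A, B satisfy: A = α·(-xp - 4yt)·(1 - r²)/(2rQ), B = α·(-yp + 4xt)·(1 - r²)/(2rQ), and 1 + 2yα·(-xp - 4yt)/(rQ) - 2xα·(-yp + 4xt)/(rQ) = -(Ax + By)·p/(t(1 - r²)). Then α = 2t/(rQ). -/
theorem stmt_6 (x y t p α A B r Q : ℝ)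
    (hr : r = Real.sqrt (x ^ 2 + y ^ 2)) (hr0 : 0 < r) (hr1 : r < 1)
    (ht : t ≠ 0) (hQ : Q = Real.sqrt (p ^ 2 + 16 * t ^ 2))
    (hA : A = α * (-x * p - 4 * y * t) * (1 - r ^ 2) / (2 * r * Q))
    (hB : B = α * (-y * p + 4 * x * t) * (1 - r ^ 2) / (2 * r * Q))
    (h3 : 1 + 2 * y * α * (-x * p - 4 * y * t) / (r * Q)
        - 2 * x * α * (-y * p + 4 * x * t) / (r * Q)
        = -(A * x + B * y) * p / (t * (1 - r ^ 2))) :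
    α = 2 * t / (r * Q) := by
  have hr2 : r ^ 2 = x ^ 2 + y ^ 2 := by
    rw [hr, Real.sq_sqrt (by positivity)]
  have hQ2 : Q ^ 2 = p ^ 2 + 16 * t ^ 2 := by
    rw [hQ, Real.sq_sqrt (by positivity)]
  have hQ0 : Q ≠ 0 := by
    have : 0 < Q := by rw [hQ]; positivity
    exact this.ne'
  have hr0' : r ≠ 0 := hr0.ne'
  have h1r : 1 - r ^ 2 ≠ 0 := by nlinarith
  have hleft : 1 + 2 * y * α * (-x * p - 4 * y * t) / (r * Q)
      - 2 * x * α * (-y * p + 4 * x * t) / (r * Q) = 1 - 8 * α * t * r / Q := by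
    field_simp
    linear_combination 8 * α * t * hr2
  have hAB : A * x + B * y = -(α * (1 - r ^ 2) * r * p / (2 * Q)) := by
    rw [hA, hB]
    field_simp
    linear_combination α * p * hr2
  rw [hleft, hAB] at h3
  field_simp at h3 ⊢
  refine mul_left_cancel₀ hQ0 ?_
  linear_combination α * r * hQ2 - h3
end

section
/- Let t be a real number with |t| < 1 and set W := 2(1 + t²)/(1 - t²) and A := 4t/(1 - t²). Then (3/4)·W² + 3·A² - (15/4)·W·A = 0 if and only if t = 4 - √15. -/
theorem stmt_15 (t W A : ℝ) (ht : |t| < 1)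
    (hW : W = 2 * (1 + t ^ 2) / (1 - t ^ 2)) (hA : A = 4 * t / (1 - t ^ 2)) :
    (3 / 4) * W ^ 2 + 3 * A ^ 2 - (15 / 4) * W * A = 0 ↔ t = 4 - Real.sqrt 15 := by
  obtain ⟨h₁, h₂⟩ := abs_lt.mp ht
  have hD : 1 - t ^ 2 ≠ 0 := by nlinarith
  have hsq : Real.sqrt 15 ^ 2 = 15 := Real.sq_sqrt (by norm_num)
  have hnonneg : 0 ≤ Real.sqrt 15 := Real.sqrt_nonneg 15
  have hfactor : (3 / 4) * W ^ 2 + 3 * A ^ 2 - (15 / 4) * W * A =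
      3 * (1 - t) ^ 2 * (t - (4 + Real.sqrt 15)) * (t - (4 - Real.sqrt 15)) /
        (1 - t ^ 2) ^ 2 := by
    have hquad : (t - (4 + Real.sqrt 15)) * (t - (4 - Real.sqrt 15)) = t ^ 2 - 8 * t + 1 := by
      linear_combination -hsq
    rw [mul_assoc _ (t - (4 + Real.sqrt 15)), hquad, hW, hA]
    field_simp
    ring
  have hne₁ : 1 - t ≠ 0 := by linarith
  have hne₂ : t - (4 + Real.sqrt 15) ≠ 0 := by linarith
  rw [hfactor, div_eq_zero_iff, or_iff_left (pow_ne_zero 2 hD), mul_eq_zero,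
    or_iff_right (by positivity), sub_eq_zero]
end

section
/- Let a, b > 0 be real numbers with b²/a² < 3/8. Define f(u) := a²·sin²(u) + b²·cos²(u), κ(u) := a·b·f(u)^{-3/2}, κ₁(u) := (deriv κ)(u)/√(f(u)), and κ₂(u) := (deriv κ₁)(u)/√(f(u)). Then there exists u₀ with 0 < u₀ < π/2 such that κ(u₀)/2 + (κ(u₀)⁴ - κ(u₀)·κ₂(u₀) + κ₁(u₀)²)/(8κ(u₀)³) + κ₁(u₀)²/(12κ(u₀)³) = 0. -/
/-- The derivative of `u ↦ a² sin² u + b² cos² u`. -/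
theorem hasDerivAt_ellipse_speed_sq (a b u : ℝ) :
    HasDerivAt (fun u => a ^ 2 * Real.sin u ^ 2 + b ^ 2 * Real.cos u ^ 2)
      (2 * (a ^ 2 - b ^ 2) * (Real.sin u * Real.cos u)) u := by
  have h := (((Real.hasDerivAt_sin u).pow 2).const_mul (a ^ 2)).add
    (((Real.hasDerivAt_cos u).pow 2).const_mul (b ^ 2))
  refine h.congr_deriv ?_
  push_cast
  ring

theorem ellipse_speed_sq_pos {a b : ℝ} (ha : 0 < a) (hb : 0 < b) (u : ℝ) :
    0 < a ^ 2 * Real.sin u ^ 2 + b ^ 2 * Real.cos u ^ 2 := by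
  rcases eq_or_ne (Real.sin u) 0 with h | h
  · have hc : Real.cos u ^ 2 = 1 := by
      have := Real.sin_sq_add_cos_sq u
      rw [h] at this
      linarith
    rw [h, hc]
    positivity
  · positivity

theorem Real.rpow_neg_three_halves {x : ℝ} (hx : 0 ≤ x) :
    x ^ (-(3 : ℝ) / 2) = 1 / Real.sqrt x ^ 3 := by
  rw [Real.sqrt_eq_rpow, ← Real.rpow_natCast, ← Real.rpow_mul hx, one_div, ← Real.rpow_neg hx]
  norm_num

theorem stmt_18 (a b : ℝ) (ha : 0 < a) (hb : 0 < b) (hba : b ^ 2 / a ^ 2 < 3 / 8)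
    (f κ κ₁ κ₂ : ℝ → ℝ)
    (hf : ∀ u, f u = a ^ 2 * Real.sin u ^ 2 + b ^ 2 * Real.cos u ^ 2)
    (hκ : ∀ u, κ u = a * b * (f u) ^ (-(3 : ℝ) / 2))
    (hκ₁ : ∀ u, κ₁ u = deriv κ u / Real.sqrt (f u))
    (hκ₂ : ∀ u, κ₂ u = deriv κ₁ u / Real.sqrt (f u)) :
    ∃ u₀, 0 < u₀ ∧ u₀ < Real.pi / 2 ∧
      κ u₀ / 2 + ((κ u₀) ^ 4 - κ u₀ * κ₂ u₀ + (κ₁ u₀) ^ 2) / (8 * (κ u₀) ^ 3)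
        + (κ₁ u₀) ^ 2 / (12 * (κ u₀) ^ 3) = 0 := by
  have hpos : ∀ u, 0 < f u := fun u => by
    rw [hf]
    exact ellipse_speed_sq_pos ha hb u
  have hspos : ∀ u, 0 < Real.sqrt (f u) := fun u => Real.sqrt_pos.2 (hpos u)
  have hsq : ∀ u, Real.sqrt (f u) ^ 2 = f u := fun u => Real.sq_sqrt (hpos u).le
  have hfun : f = fun u => a ^ 2 * Real.sin u ^ 2 + b ^ 2 * Real.cos u ^ 2 := funext hf
  have hfd : ∀ u, HasDerivAt f (2 * (a ^ 2 - b ^ 2) * (Real.sin u * Real.cos u)) u := fun u => by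
    rw [hfun]
    exact hasDerivAt_ellipse_speed_sq a b u
  have hκs : κ = fun u => a * b / Real.sqrt (f u) ^ 3 := funext fun u => by
    rw [hκ, Real.rpow_neg_three_halves (hpos u).le, mul_one_div]
  have hκd : ∀ u, HasDerivAt κ
      (-3 * a * b * (a ^ 2 - b ^ 2) * (Real.sin u * Real.cos u) / Real.sqrt (f u) ^ 5) u :=
    fun u => by
    rw [hκs]
    have hs := (hspos u).ne'
    refine ((hasDerivAt_const u (a * b)).div (((hfd u).sqrt (hpos u).ne').pow 3)
      (pow_ne_zero 3 hs)).congr_deriv ?_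
    simp only [Pi.pow_apply]
    field_simp
    push_cast
    ring
  have hκ₁f : κ₁ = fun u =>
      -3 * a * b * (a ^ 2 - b ^ 2) * (Real.sin u * Real.cos u) / f u ^ 3 := funext fun u => by
    have hf3 : f u ^ 3 = Real.sqrt (f u) ^ 5 * Real.sqrt (f u) := by
      rw [← pow_succ, pow_mul _ 2 3, hsq]
    rw [hκ₁, (hκd u).deriv, hf3, div_div]
  have hκ₁d : ∀ u, HasDerivAt κ₁ (-3 * a * b * (a ^ 2 - b ^ 2) *
      ((Real.cos u ^ 2 - Real.sin u ^ 2) * f u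
        - 6 * (a ^ 2 - b ^ 2) * (Real.sin u * Real.cos u) ^ 2) / f u ^ 4) u := fun u => by
    rw [hκ₁f]
    have hfu := (hpos u).ne'
    refine ((((Real.hasDerivAt_sin u).mul (Real.hasDerivAt_cos u)).const_mul
      (-3 * a * b * (a ^ 2 - b ^ 2))).div ((hfd u).pow 3) (pow_ne_zero 3 hfu)).congr_deriv ?_
    simp only [Pi.pow_apply, Pi.mul_apply]
    field_simp
    push_cast
    ring
  have hκ₂f : κ₂ = fun u => -3 * a * b * (a ^ 2 - b ^ 2) *
      ((Real.cos u ^ 2 - Real.sin u ^ 2) * f u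
        - 6 * (a ^ 2 - b ^ 2) * (Real.sin u * Real.cos u) ^ 2)
      / (f u ^ 4 * Real.sqrt (f u)) := funext fun u => by
    rw [hκ₂, (hκ₁d u).deriv, div_div]
  have hcf : Continuous f := continuous_iff_continuousAt.2 fun u => (hfd u).continuousAt
  have hκpos : ∀ u, 0 < κ u := fun u => by
    rw [hκs]
    have := hspos u
    positivity
  have hcκ : Continuous κ := by
    rw [hκs]
    exact continuous_const.div (by fun_prop) fun u => pow_ne_zero 3 (hspos u).ne'
  have hcκ₁ : Continuous κ₁ := by
    rw [hκ₁f]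
    exact Continuous.div (by fun_prop) (by fun_prop) fun u => pow_ne_zero 3 (hpos u).ne'
  have hcκ₂ : Continuous κ₂ := by
    rw [hκ₂f]
    exact Continuous.div (by fun_prop) (by fun_prop) fun u =>
      mul_ne_zero (pow_ne_zero 4 (hpos u).ne') (hspos u).ne'
  let H : ℝ → ℝ := fun u =>
    κ u / 2 + ((κ u) ^ 4 - κ u * κ₂ u + (κ₁ u) ^ 2) / (8 * (κ u) ^ 3)
      + (κ₁ u) ^ 2 / (12 * (κ u) ^ 3)
  have hcH : Continuous H := by
    have h8 : ∀ u, 8 * (κ u) ^ 3 ≠ 0 := fun u => by have := hκpos u; positivity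
    have h12 : ∀ u, 12 * (κ u) ^ 3 ≠ 0 := fun u => by have := hκpos u; positivity
    exact ((hcκ.div_const 2).add (Continuous.div (by fun_prop) (by fun_prop) h8)).add
      (Continuous.div (by fun_prop) (by fun_prop) h12)
  have hlt : 8 * b ^ 2 < 3 * a ^ 2 := by
    rw [div_lt_div_iff₀ (by positivity) (by norm_num)] at hba
    linarith
  have hab : 0 < a ^ 2 - b ^ 2 := by nlinarith [sq_nonneg b, pow_pos ha 2]
  have h0 : 0 < H 0 := by
    have e : H 0 = (5 * a ^ 2 + 3 * (a ^ 2 - b ^ 2)) / (8 * a * b ^ 2) := by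
      have hf0 : f 0 = b ^ 2 := by simp [hf]
      simp only [H, hκs, hκ₁f, hκ₂f, hf0, Real.sqrt_sq hb.le, Real.sin_zero, Real.cos_zero]
      field_simp
      ring
    rw [e]
    positivity
  have h1 : H (Real.pi / 2) < 0 := by
    have e : H (Real.pi / 2) = (8 * b ^ 2 - 3 * a ^ 2) / (8 * b * a ^ 2) := by
      have hf1 : f (Real.pi / 2) = a ^ 2 := by simp [hf]
      simp only [H, hκs, hκ₁f, hκ₂f, hf1, Real.sqrt_sq ha.le, Real.sin_pi_div_two,
        Real.cos_pi_div_two]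
      field_simp
      ring
    rw [e]
    exact div_neg_of_neg_of_pos (by linarith) (by positivity)
  obtain ⟨u₀, hu, hH⟩ :=
    intermediate_value_Ioo' Real.pi_div_two_pos.le hcH.continuousOn ⟨h1, h0⟩
  exact ⟨u₀, hu.1, hu.2, hH⟩
end
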